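/- arXiv:1603.09565 — 3 statements merged into one kernel-verified Lean document; each statement's English description precedes it below -/
import Mathlib

section
/- Let K/k be a finite Galois extension whose Galois group is cyclic, generated by θ, let v ∈ K^m be a Gabidulin vector and let 1 ≤ d < m. Then the intersection ∩_{i=0}^{d−1} θ^i(C̃(v,θ,d)) equals the one-dimensional K-subspace spanned by θ^{d−1}(v), i.e. span_K{v} = θ^{1−d}(∩_{i=0}^{d−1} θ^i(C̃(v,θ,d))). -/
/-- The Gabidulin-like code `C̃(v,θ,d) = span_K{v, θ(v), …, θ^{d−1}(v)} ≤ K^m`,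
where `θ` acts entrywise on `K^m`. -/
def gabCode {k K : Type*} [Field k] [Field K] [Algebra k K] {m : ℕ}
    (θ : K ≃ₐ[k] K) (v : Fin m → K) (d : ℕ) : Submodule K (Fin m → K) :=
  Submodule.span K (Set.range fun i : Fin d => (fun j => (θ ^ (i : ℕ)) (v j) : Fin m → K))

/-- If the family `u` is linearly independent on `s ∪ t`, then the intersection of the spans of
`u '' s` and `u '' t` is contained in the span of `u '' (s ∩ t)`. -/
theorem LinearIndepOn.span_image_inf_span_image_le {R M ι : Type*} [Ring R] [AddCommGroup M]
    [Module R M] {u : ι → M} {s t : Set ι} (h : LinearIndepOn R u (s ∪ t)) :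
    Submodule.span R (u '' s) ⊓ Submodule.span R (u '' t) ≤
      Submodule.span R (u '' (s ∩ t)) := by
  rintro x ⟨hs, ht⟩
  obtain ⟨a, ha, hax⟩ := (Finsupp.mem_span_image_iff_linearCombination R).1 hs
  obtain ⟨b, hb, hbx⟩ := (Finsupp.mem_span_image_iff_linearCombination R).1 ht
  have hab : a - b = 0 := by
    refine linearIndepOn_iff.1 h (a - b) (Submodule.sub_mem _ ?_ ?_) ?_
    · exact Finsupp.supported_mono Set.subset_union_left ha
    · exact Finsupp.supported_mono Set.subset_union_right hb
    · rw [map_sub, hax, hbx, sub_self]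
  obtain rfl : a = b := sub_eq_zero.1 hab
  refine (Finsupp.mem_span_image_iff_linearCombination R).2 ⟨a, ?_, hax⟩
  rw [Finsupp.supported_inter]
  exact ⟨ha, hb⟩

/-- In a Galois extension whose group is generated by `θ`, an element fixed by `θ` lies in the
base field. -/
theorem mem_range_algebraMap_of_generator_fixed {k K : Type*} [Field k] [Field K] [Algebra k K]
    [FiniteDimensional k K] [IsGalois k K] {θ : K ≃ₐ[k] K}
    (hθ : ∀ σ : K ≃ₐ[k] K, σ ∈ Subgroup.zpowers θ) {x : K} (hx : θ x = x) :
    x ∈ Set.range (algebraMap k K) := by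
  rw [IsGalois.mem_range_algebraMap_iff_fixed]
  intro σ
  have hle : Subgroup.zpowers θ ≤ MulAction.stabilizer (K ≃ₐ[k] K) x :=
    Subgroup.zpowers_le.2 hx
  exact hle (hθ σ)

/-- The columns of the Moore matrix `(θ ^ i (v j))` of a `k`-linearly independent family are
linearly independent over `K`. -/
theorem eq_zero_of_sum_mul_pow_apply_eq_zero {k K : Type*} [Field k] [Field K] [Algebra k K]
    [FiniteDimensional k K] [IsGalois k K] {θ : K ≃ₐ[k] K}
    (hθ : ∀ σ : K ≃ₐ[k] K, σ ∈ Subgroup.zpowers θ) {n : ℕ} {v : Fin n → K}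
    (hv : LinearIndependent k v) {a : Fin n → K}
    (ha : ∀ i < n, ∑ j, a j * (θ ^ i) (v j) = 0) : a = 0 := by
  induction n with
  | zero => exact Subsingleton.elim _ _
  | succ n ih =>
    have hv' : LinearIndependent k (fun j : Fin n => v j.castSucc) :=
      hv.comp _ (Fin.castSucc_injective n)
    by_cases hlast : a (Fin.last n) = 0
    · have h0 : (fun j : Fin n => a j.castSucc) = 0 := by
        refine ih hv' fun i hi => ?_
        simpa [Fin.sum_univ_castSucc, hlast] using ha i (by omega)
      funext j
      induction j using Fin.lastCases with
      | last => exact hlast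
      | cast j => exact congrFun h0 j
    · exfalso
      set b : Fin (n + 1) → K := fun j => a j / a (Fin.last n) with hb
      have hb1 : b (Fin.last n) = 1 := div_self hlast
      have hbs : ∀ i < n + 1, ∑ j, b j * (θ ^ i) (v j) = 0 := by
        intro i hi
        have h := congrArg (fun x => (a (Fin.last n))⁻¹ * x) (ha i hi)
        simp only [Finset.mul_sum, mul_zero] at h
        rw [← h]
        exact Finset.sum_congr rfl fun j _ => by simp only [hb]; ring
      have hsub : ∀ i < n, ∑ j : Fin n,
          (b j.castSucc - θ.symm (b j.castSucc)) * (θ ^ i) (v j.castSucc) = 0 := by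
        intro i hi
        have h1 := congrArg θ.symm (hbs (i + 1) (by omega))
        have h2 := hbs i (by omega)
        have hs : ∀ x, θ.symm ((θ ^ (i + 1)) x) = (θ ^ i) x := fun x => by
          rw [pow_succ', AlgEquiv.mul_apply, AlgEquiv.symm_apply_apply]
        simp only [map_sum, map_mul, hs, map_zero] at h1
        rw [Fin.sum_univ_castSucc, hb1] at h1 h2
        rw [map_one] at h1
        simp only [sub_mul, Finset.sum_sub_distrib]
        linear_combination h2 - h1
      have hfix := congrFun (ih hv' hsub)
      have hmem : ∀ j, b j ∈ Set.range (algebraMap k K) := by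
        intro j
        induction j using Fin.lastCases with
        | last => exact ⟨1, by rw [hb1, map_one]⟩
        | cast j =>
          refine mem_range_algebraMap_of_generator_fixed hθ ?_
          rw [← AlgEquiv.eq_symm_apply]
          exact sub_eq_zero.1 (hfix j)
      choose c hc using hmem
      have hc0 : c (Fin.last n) = 0 := by
        refine Fintype.linearIndependent_iff.1 hv c ?_ _
        simpa [Algebra.smul_def, hc] using hbs 0 (by omega)
      have := hc (Fin.last n)
      rw [hc0, hb1, map_zero] at this
      exact zero_ne_one this

/-- The first `n` iterates under `θ` of a Gabidulin vector of length `n` are linearly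
independent. -/
theorem linearIndependent_pow_apply {k K : Type*} [Field k] [Field K] [Algebra k K]
    [FiniteDimensional k K] [IsGalois k K] {θ : K ≃ₐ[k] K}
    (hθ : ∀ σ : K ≃ₐ[k] K, σ ∈ Subgroup.zpowers θ) {n : ℕ} {v : Fin n → K}
    (hv : LinearIndependent k v) :
    LinearIndependent K (fun (i : Fin n) (j : Fin n) => (θ ^ (i : ℕ)) (v j)) := by
  let A : Matrix (Fin n) (Fin n) K := Matrix.of fun i j => (θ ^ (i : ℕ)) (v j)
  have hA : Function.Injective A.mulVec := by
    refine (injective_iff_map_eq_zero A.mulVecLin).2 fun a ha => ?_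
    refine eq_zero_of_sum_mul_pow_apply_eq_zero hθ hv fun i hi => ?_
    simpa [A, Matrix.mulVec, dotProduct, mul_comm] using congrFun ha ⟨i, hi⟩
  exact Matrix.linearIndependent_rows_iff_isUnit.2 (Matrix.mulVec_injective_iff_isUnit.1 hA)

/-- Any `n` consecutive iterates under `θ` of a Gabidulin vector of length `n` are linearly
independent. -/
theorem linearIndepOn_pow_apply_Ico {k K : Type*} [Field k] [Field K] [Algebra k K]
    [FiniteDimensional k K] [IsGalois k K] {θ : K ≃ₐ[k] K}
    (hθ : ∀ σ : K ≃ₐ[k] K, σ ∈ Subgroup.zpowers θ) {n : ℕ} {v : Fin n → K}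
    (hv : LinearIndependent k v) (p : ℕ) :
    LinearIndepOn K (fun (i : ℕ) (j : Fin n) => (θ ^ i) (v j)) (Set.Ico p (p + n)) := by
  have hw : LinearIndependent k (fun j => (θ ^ p) (v j)) :=
    hv.map' (θ ^ p).toLinearMap (LinearMap.ker_eq_bot.2 (θ ^ p).injective)
  let f : Set.Ico p (p + n) → Fin n := fun i => ⟨i - p, by have := i.2.1; have := i.2.2; omega⟩
  have hf : Function.Injective f := by
    intro x y hxy
    have h1 : (x : ℕ) - p = y - p := congrArg Fin.val hxy
    have := x.2.1
    have := y.2.1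
    exact Subtype.ext (by omega)
  have h := (linearIndependent_pow_apply hθ hw).comp f hf
  unfold LinearIndepOn
  convert! h using 1
  funext i j
  have hi : i.1 - p + p = i.1 := Nat.sub_add_cancel i.2.1
  change (θ ^ i.1) (v j) = (θ ^ (i.1 - p)) ((θ ^ p) (v j))
  rw [← AlgEquiv.mul_apply, ← pow_add, hi]

/-- Applying `θ ^ p` to a word of `gabCode θ v d` gives a combination of the iterates
`θ ^ i v` with `p ≤ i < p + d`. -/
theorem pow_apply_mem_span_of_mem_gabCode {k K : Type*} [Field k] [Field K] [Algebra k K]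
    {m : ℕ} {θ : K ≃ₐ[k] K} {v : Fin m → K} {d : ℕ} (p : ℕ) {w : Fin m → K}
    (hw : w ∈ gabCode θ v d) :
    (fun j => (θ ^ p) (w j)) ∈ Submodule.span K
      ((fun (i : ℕ) (j : Fin m) => (θ ^ i) (v j)) '' Set.Ico p (p + d)) := by
  unfold gabCode at hw
  induction hw using Submodule.span_induction with
  | mem x hx =>
    obtain ⟨i, rfl⟩ := hx
    refine Submodule.subset_span ⟨p + i, ⟨by omega, by omega⟩, ?_⟩
    funext j
    simp only [pow_add, AlgEquiv.mul_apply]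
  | zero =>
    convert! Submodule.zero_mem _ using 1
    funext j
    simp
  | add x y _ _ hx hy =>
    convert! Submodule.add_mem _ hx hy using 1
    funext j
    simp
  | smul c x _ hx =>
    convert! Submodule.smul_mem _ ((θ ^ p) c) hx using 1
    funext j
    simp

/-- Let `K/k` be a finite Galois extension with cyclic Galois group generated by `θ`,
let `v ∈ K^m` be a Gabidulin vector (its entries span a `k`-subspace of dimension `m`)
and `1 ≤ d < m`.  Then `∩_{i=0}^{d−1} θ^i(C̃(v,θ,d))` is the one-dimensional `K`-subspace
spanned by `θ^{d−1}(v)`. -/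
theorem inter_shifts_of_gabCode {k K : Type*} [Field k] [Field K] [Algebra k K]
    [FiniteDimensional k K] [IsGalois k K]
    (θ : K ≃ₐ[k] K) (hθ : ∀ σ : K ≃ₐ[k] K, σ ∈ Subgroup.zpowers θ)
    {m : ℕ} (v : Fin m → K)
    (hv : Module.finrank k (Submodule.span k (Set.range v)) = m)
    (d : ℕ) (hd1 : 1 ≤ d) (hdm : d < m) :
    (⋂ i ∈ Finset.range d,
        (fun w : Fin m → K => (fun j => (θ ^ i) (w j) : Fin m → K)) ''
          (gabCode θ v d : Set (Fin m → K)))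
      = (Submodule.span K {(fun j => (θ ^ (d - 1)) (v j) : Fin m → K)} :
          Submodule K (Fin m → K)) := by
  have hli : LinearIndependent k v :=
    linearIndependent_iff_card_eq_finrank_span.2 (by simpa [Set.finrank] using hv.symm)
  set u : ℕ → Fin m → K := fun i j => (θ ^ i) (v j) with hu
  apply Set.Subset.antisymm
  · intro x hx
    simp only [Set.mem_iInter, Finset.mem_range] at hx
    have hmem : ∀ i < d, x ∈ Submodule.span K (u '' Set.Ico i (i + d)) := by
      intro i hi
      obtain ⟨w, hw, rfl⟩ := hx i hi
      exact pow_apply_mem_span_of_mem_gabCode i hw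
    have hind : ∀ i < d, x ∈ Submodule.span K (u '' Set.Ico i d) := by
      intro i
      induction i with
      | zero => intro hi; simpa using hmem 0 hi
      | succ i ih =>
        intro hi
        have hIoo : Set.Ico i d ∪ Set.Ico (i + 1) (i + 1 + d) ⊆ Set.Ico i (i + m) := by
          rintro y (⟨h1, h2⟩ | ⟨h1, h2⟩) <;> constructor <;> omega
        have hinter : Set.Ico i d ∩ Set.Ico (i + 1) (i + 1 + d) ⊆ Set.Ico (i + 1) d := by
          rintro y ⟨⟨h1, h2⟩, ⟨h3, h4⟩⟩
          exact ⟨h3, h2⟩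
        exact Submodule.span_mono (Set.image_mono hinter)
          (((linearIndepOn_pow_apply_Ico hθ hli i).mono hIoo).span_image_inf_span_image_le
            ⟨ih (by omega), hmem (i + 1) hi⟩)
    have hlast := hind (d - 1) (by omega)
    have hIco : Set.Ico (d - 1) d = {d - 1} := by
      ext y
      simp only [Set.mem_Ico, Set.mem_singleton_iff]
      omega
    rwa [hIco, Set.image_singleton] at hlast
  · intro x hx
    obtain ⟨c, rfl⟩ := Submodule.mem_span_singleton.1 hx
    simp only [Set.mem_iInter, Finset.mem_range]
    intro i hi
    refine ⟨(θ ^ i).symm c • u (d - 1 - i), ?_, ?_⟩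
    · exact Submodule.smul_mem _ _
        (Submodule.subset_span ⟨⟨d - 1 - i, by omega⟩, rfl⟩)
    · funext j
      have hpow : (θ ^ i) ((θ ^ (d - 1 - i)) (v j)) = (θ ^ (d - 1)) (v j) := by
        rw [← AlgEquiv.mul_apply, ← pow_add]
        congr 2
        omega
      simp only [hu, Pi.smul_apply, smul_eq_mul, map_mul, AlgEquiv.apply_symm_apply, hpow]
end

section
/- Let K/k be a finite Galois extension whose Galois group is cyclic, generated by θ, let v, w ∈ K^m be Gabidulin vectors and let 1 ≤ d < m. Then C̃(v,θ,d) = C̃(w,θ,d) if and only if v = α·w for some nonzero α ∈ K. -/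
section GabidulinCode

variable {k K : Type*} [Field k] [Field K] [Algebra k K] {m : ℕ}

theorem pow_apply_mem_gabCode (θ : K ≃ₐ[k] K) (v : Fin m → K) {i d : ℕ} (hi : i < d) :
    (fun j => (θ ^ i) (v j)) ∈ gabCode θ v d :=
  Submodule.subset_span ⟨⟨i, hi⟩, rfl⟩

theorem gabCode_le_iff (θ : K ≃ₐ[k] K) (v : Fin m → K) (d : ℕ) (S : Submodule K (Fin m → K)) :
    gabCode θ v d ≤ S ↔ ∀ i < d, (fun j => (θ ^ i) (v j)) ∈ S := by
  rw [gabCode, Submodule.span_le, Set.range_subset_iff]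
  exact ⟨fun h i hi => h ⟨i, hi⟩, fun h i => h i i.2⟩

theorem gabCode_smul_le (θ : K ≃ₐ[k] K) (α : K) (v : Fin m → K) (d : ℕ) :
    gabCode θ (α • v) d ≤ gabCode θ v d := by
  rw [gabCode_le_iff]
  intro i hi
  have h := Submodule.smul_mem _ ((θ ^ i) α) (pow_apply_mem_gabCode θ v hi)
  convert h using 1
  ext j
  simp

theorem gabCode_smul (θ : K ≃ₐ[k] K) {α : K} (hα : α ≠ 0) (v : Fin m → K) (d : ℕ) :
    gabCode θ (α • v) d = gabCode θ v d := by
  refine le_antisymm (gabCode_smul_le θ α v d) ?_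
  simpa [smul_smul, inv_mul_cancel₀ hα] using gabCode_smul_le θ α⁻¹ (α • v) d

/-- Applying `θ ^ j` to a codeword shifts the code by `j`. -/
theorem pow_apply_mem_gabCode_add (θ : K ≃ₐ[k] K) (v : Fin m → K) {n : ℕ} (j : ℕ)
    {x : Fin m → K} (hx : x ∈ gabCode θ v n) :
    (fun l => (θ ^ j) (x l)) ∈ gabCode θ v (n + j) := by
  induction hx using Submodule.span_induction with
  | mem x hx =>
    obtain ⟨i, rfl⟩ := hx
    convert pow_apply_mem_gabCode θ v (show j + (i : ℕ) < n + j by omega) using 2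
    rw [pow_add, AlgEquiv.mul_apply]
  | zero =>
    convert (gabCode θ v (n + j)).zero_mem using 1
    ext l
    simp
  | add x y _ _ hx hy =>
    convert Submodule.add_mem _ hx hy using 1
    ext l
    simp
  | smul a x _ hx =>
    convert Submodule.smul_mem _ ((θ ^ j) a) hx using 1
    ext l
    simp

theorem exists_add_smul_of_mem_gabCode_succ (θ : K ≃ₐ[k] K) (v : Fin m → K) {n : ℕ}
    {u : Fin m → K} (hu : u ∈ gabCode θ v (n + 1)) :
    ∃ x ∈ gabCode θ v n, ∃ a : K, u = x + a • fun l => (θ ^ n) (v l) := by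
  have hle : gabCode θ v (n + 1) ≤
      gabCode θ v n ⊔ Submodule.span K {fun l => (θ ^ n) (v l)} := by
    rw [gabCode_le_iff]
    intro i hi
    rcases Nat.lt_succ_iff_lt_or_eq.mp hi with h | rfl
    · exact Submodule.mem_sup_left (pow_apply_mem_gabCode θ v h)
    · exact Submodule.mem_sup_right (Submodule.mem_span_singleton_self _)
  obtain ⟨x, hx, y, hy, rfl⟩ := Submodule.mem_sup.mp (hle hu)
  obtain ⟨a, rfl⟩ := Submodule.mem_span_singleton.mp hy
  exact ⟨x, hx, a, rfl⟩

theorem mem_gabCode_of_mem_gabCode_succ (θ : K ≃ₐ[k] K) (v : Fin m → K) {n j : ℕ}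
    {u : Fin m → K} (hu : u ∈ gabCode θ v (n + 1))
    (huj : (fun l => (θ ^ j) (u l)) ∈ gabCode θ v (n + j))
    (hv : (fun l => (θ ^ (n + j)) (v l)) ∉ gabCode θ v (n + j)) :
    u ∈ gabCode θ v n := by
  obtain ⟨x, hx, a, rfl⟩ := exists_add_smul_of_mem_gabCode_succ θ v hu
  have hmem : (θ ^ j) a • (fun l => (θ ^ (n + j)) (v l)) ∈ gabCode θ v (n + j) := by
    convert Submodule.sub_mem _ huj (pow_apply_mem_gabCode_add θ v j hx) using 1
    ext l
    simp [add_comm n j, pow_add]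
  rcases eq_or_ne a 0 with rfl | ha
  · simpa using hx
  · exact absurd ((Submodule.smul_mem_iff _ ((map_ne_zero (θ ^ j)).mpr ha)).mp hmem) hv

/-- The columns of the Moore matrix `(θ ^ i (v j))` are independent over `K` as soon as the `v j`
are independent over the fixed field of `θ`. -/
theorem eq_zero_of_sum_mul_pow_apply_eq_zero_s4 (θ : K ≃ₐ[k] K)
    (hfix : ∀ x : K, θ x = x → x ∈ Set.range (algebraMap k K)) {n : ℕ} (v : Fin n → K)
    (hv : LinearIndependent k v) (x : Fin n → K)
    (hx : ∀ i < n, ∑ j, x j * (θ ^ i) (v j) = 0) : x = 0 := by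
  induction n with
  | zero => exact Subsingleton.elim _ _
  | succ n ih =>
    have hcast : LinearIndependent k fun j : Fin n => v j.castSucc :=
      hv.comp _ (Fin.castSucc_injective n)
    by_cases hlast : x (Fin.last n) = 0
    · have h := ih (fun j => v j.castSucc) hcast (fun j => x j.castSucc) fun i hi => by
        simpa [Fin.sum_univ_castSucc, hlast] using hx i (by omega)
      ext j
      refine Fin.lastCases hlast (fun j => ?_) j
      exact congrFun h j
    · exfalso
      set y : Fin (n + 1) → K := fun j => (x (Fin.last n))⁻¹ * x j with hy
      have hylast : y (Fin.last n) = 1 := inv_mul_cancel₀ hlast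
      have hysum : ∀ i < n + 1, ∑ j, y j * (θ ^ i) (v j) = 0 := fun i hi => by
        simp only [hy, mul_assoc, ← Finset.mul_sum, hx i hi, mul_zero]
      have hθv : LinearIndependent k fun j : Fin n => θ (v j.castSucc) :=
        hcast.map' θ.toLinearMap (LinearMap.ker_eq_bot.mpr θ.injective)
      have hdiff := ih _ hθv (fun j => y j.castSucc - θ (y j.castSucc)) fun i hi => by
        have h1 := hysum (i + 1) (by omega)
        have h2 := congrArg θ (hysum i (by omega))
        simp only [map_sum, map_mul, map_zero, ← AlgEquiv.mul_apply, ← pow_succ'] at h2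
        rw [Fin.sum_univ_castSucc, hylast] at h1 h2
        rw [map_one] at h2
        simp only [sub_mul, Finset.sum_sub_distrib, ← AlgEquiv.mul_apply, ← pow_succ]
        linear_combination h1 - h2
      have hyfix : ∀ j, θ (y j) = y j := by
        refine Fin.lastCases (by rw [hylast, map_one]) fun j => ?_
        exact (sub_eq_zero.mp (congrFun hdiff j)).symm
      choose c hc using fun j => hfix (y j) (hyfix j)
      have hzero := Fintype.linearIndependent_iff.mp hv c (by
        simpa [Algebra.smul_def, hc] using hysum 0 (by omega)) (Fin.last n)
      have := hc (Fin.last n)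
      rw [hzero, map_zero, hylast] at this
      exact zero_ne_one this

theorem linearIndependent_pow_apply_s4 (θ : K ≃ₐ[k] K)
    (hfix : ∀ x : K, θ x = x → x ∈ Set.range (algebraMap k K)) (v : Fin m → K)
    (hv : LinearIndependent k v) :
    LinearIndependent K fun (i : Fin m) (j : Fin m) => (θ ^ (i : ℕ)) (v j) := by
  let M : Matrix (Fin m) (Fin m) K := Matrix.of fun i j => (θ ^ (i : ℕ)) (v j)
  have hM : IsUnit M := by
    rw [← Matrix.mulVec_injective_iff_isUnit]
    refine (injective_iff_map_eq_zero M.mulVecLin).mpr fun x hx => ?_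
    refine eq_zero_of_sum_mul_pow_apply_eq_zero_s4 θ hfix v hv x fun i hi => ?_
    simpa [M, Matrix.mulVec, dotProduct, mul_comm] using congrFun hx ⟨i, hi⟩
  exact Matrix.linearIndependent_rows_iff_isUnit.mpr hM

theorem pow_apply_notMem_gabCode (θ : K ≃ₐ[k] K)
    (hfix : ∀ x : K, θ x = x → x ∈ Set.range (algebraMap k K)) (v : Fin m → K)
    (hv : LinearIndependent k v) {d : ℕ} (hd : d < m) :
    (fun j => (θ ^ d) (v j)) ∉ gabCode θ v d := by
  have h := (linearIndependent_pow_apply_s4 θ hfix v hv).notMem_span_image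
    (s := {i | (i : ℕ) < d}) (x := ⟨d, hd⟩) (by simp)
  refine fun hmem => h ((gabCode_le_iff θ v d _).mpr (fun i hi => ?_) hmem)
  exact Submodule.subset_span ⟨⟨i, hi.trans hd⟩, hi, rfl⟩

end GabidulinCode

/-- Let `K/k` be a finite Galois extension with cyclic Galois group generated by `θ`,
let `v, w ∈ K^m` be Gabidulin vectors and `1 ≤ d < m`.  Then
`C̃(v,θ,d) = C̃(w,θ,d)` if and only if `v = α·w` for some nonzero `α ∈ K`. -/
theorem gabCode_eq_iff_smul {k K : Type*} [Field k] [Field K] [Algebra k K]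
    [FiniteDimensional k K] [IsGalois k K]
    (θ : K ≃ₐ[k] K) (hθ : ∀ σ : K ≃ₐ[k] K, σ ∈ Subgroup.zpowers θ)
    {m : ℕ} (v w : Fin m → K)
    (hv : Module.finrank k (Submodule.span k (Set.range v)) = m)
    (hw : Module.finrank k (Submodule.span k (Set.range w)) = m)
    (d : ℕ) (hd1 : 1 ≤ d) (hdm : d < m) :
    gabCode θ v d = gabCode θ w d ↔ ∃ α : K, α ≠ 0 ∧ v = α • w := by
  have hfix : ∀ x : K, θ x = x → x ∈ Set.range (algebraMap k K) := fun x hx => by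
    refine (IsGalois.mem_range_algebraMap_iff_fixed x).mpr fun σ => ?_
    have hle : Subgroup.zpowers θ ≤ MulAction.stabilizer (K ≃ₐ[k] K) x :=
      Subgroup.zpowers_le.mpr hx
    exact hle (hθ σ)
  have hlin : LinearIndependent k w :=
    linearIndependent_iff_card_eq_finrank_span.mpr (by rw [Set.finrank, hw, Fintype.card_fin])
  constructor
  · intro h
    have hdesc : ∀ n, 1 ≤ n → n ≤ d → v ∈ gabCode θ w n := fun n hn1 hnd => by
      induction hnd using Nat.decreasingInduction with
      | self =>
        rw [← h]
        simpa using pow_apply_mem_gabCode θ v hd1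
      | of_succ n hn ih =>
        have hadd : n + (d - n) = d := by omega
        refine mem_gabCode_of_mem_gabCode_succ θ w (j := d - n) (ih (by omega)) ?_ ?_
        · rw [hadd, ← h]
          exact pow_apply_mem_gabCode θ v (by omega)
        · rw [hadd]
          exact pow_apply_notMem_gabCode θ hfix w hlin hdm
    obtain ⟨x, hx, α, hα⟩ := exists_add_smul_of_mem_gabCode_succ θ w (hdesc 1 le_rfl hd1)
    have hx0 : x = 0 := by simpa [gabCode] using hx
    have hvα : v = α • w := by
      rw [hα, hx0, zero_add]
      simp
    refine ⟨α, ?_, hvα⟩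
    rintro rfl
    have hm : m = 0 := by
      rw [← hv, Submodule.finrank_eq_zero, Submodule.span_eq_bot]
      rintro _ ⟨j, rfl⟩
      simp [hvα]
    omega
  · rintro ⟨α, hα, rfl⟩
    exact gabCode_smul θ hα w d
end

section
/- Let K/k be a field extension of finite degree ℓ and let C̃ be a K-subspace of K^m. Let L := {φ ∈ End_k(K) : for every c = (c_1,…,c_m) ∈ C̃, the vector (φ(c_1),…,φ(c_m)) lies in C̃}. Then there exists an intermediate field k ≤ F ≤ K such that L equals the centralizer in End_k(K) of the multiplication operators {μ_a : a ∈ F}, i.e., L = End_F(K), which is isomorphic as a k-algebra to the algebra of s×s matrices over F with s = [K:F]. -/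
/-- A subspace of `K^m` has a basis in reduced echelon form: there are pivot coordinates `a i` and
vectors `e i` dual to them. -/
theorem Submodule.exists_pivots {K : Type*} [Field K] {m : ℕ} (C : Submodule K (Fin m → K)) :
    ∃ (n : ℕ) (a : Fin n → Fin m) (e : Fin n → Fin m → K),
      (∀ i, e i ∈ C) ∧ (∀ i j, e i (a j) = if j = i then 1 else 0) ∧
        ∀ c ∈ C, c = ∑ i, c (a i) • e i := by
  classical
  let f : Fin m → Module.Dual K C := fun j => (LinearMap.proj j).comp C.subtype
  obtain ⟨κ, a, ha, hspan, hli⟩ := exists_linearIndependent' K f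
  have : Finite κ := Finite.of_injective a ha
  have hker : ⨅ i, LinearMap.ker (f (a i)) = ⊥ := by
    refine (Submodule.eq_bot_iff _).2 fun c hc => ?_
    have h : Submodule.span K (Set.range f) ≤ LinearMap.ker (Module.Dual.eval K C c) := by
      rw [← hspan, Submodule.span_le]
      rintro _ ⟨i, rfl⟩
      exact (Submodule.mem_iInf _).1 hc i
    ext j
    exact h (Submodule.subset_span ⟨j, rfl⟩)
  let n := Nat.card κ
  let σ : Fin n ≃ κ := (Finite.equivFin κ).symm
  have hdual : ∀ i : Fin n, ∃ c : C, ∀ j : Fin n, f (a (σ j)) c = if j = i then 1 else 0 := by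
    intro i
    have hli' := hli.comp σ σ.injective
    obtain ⟨g, hg⟩ := (Finsupp.lapply i ∘ₗ hli'.repr).exists_extend
    refine ⟨(Module.evalEquiv K C).symm g, fun j => ?_⟩
    rw [Module.apply_evalEquiv_symm_apply]
    have h := LinearMap.congr_fun hg ⟨f (a (σ j)), Submodule.subset_span ⟨j, rfl⟩⟩
    have hr := hli'.repr_eq_single j ⟨f (a (σ j)), Submodule.subset_span ⟨j, rfl⟩⟩ rfl
    simpa [hr, Finsupp.single_apply] using h
  choose e he using hdual
  refine ⟨n, fun i => a (σ i), fun i => e i, fun i => (e i).2, he, fun c hc => ?_⟩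
  have hzero : (⟨c, hc⟩ : C) - ∑ i, c (a (σ i)) • e i = 0 := by
    rw [← Submodule.mem_bot K, ← hker, Submodule.mem_iInf]
    intro i
    obtain ⟨i, rfl⟩ := σ.surjective i
    rw [LinearMap.mem_ker, map_sub, map_sum]
    simp [he]
    simp [f]
  simpa using congrArg Subtype.val (sub_eq_zero.1 hzero)

/-- Over an intermediate field `F`, the centralizer of the multiplications by elements of `F` is
the algebra of `F`-linear endomorphisms. -/
def IntermediateField.centralizerLmulEquivEnd {k K : Type*} [Field k] [Field K] [Algebra k K]
    (F : IntermediateField k K) :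
    Subalgebra.centralizer k
      ((fun a : K => (Algebra.lmul k K a : Module.End k K)) '' (F : Set K)) ≃ₐ[k]
      Module.End F K where
  toFun φ :=
    { toFun := φ.1
      map_add' := map_add φ.1
      map_smul' := fun a x =>
        (LinearMap.congr_fun ((Subalgebra.mem_centralizer_iff k).1 φ.2 _ ⟨a, a.2, rfl⟩) x).symm }
  invFun ψ := ⟨ψ.restrictScalars k, by
    rw [Subalgebra.mem_centralizer_iff]
    rintro _ ⟨a, ha, rfl⟩
    ext x
    exact (ψ.map_smul (⟨a, ha⟩ : F) x).symm⟩
  left_inv _ := rfl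
  right_inv _ := rfl
  map_mul' _ _ := rfl
  map_add' _ _ := rfl
  commutes' _ := rfl

/-- An endomorphism commuting with the multiplications by a set `S` commutes with the
multiplications by the field generated by `S`. -/
theorem IntermediateField.mem_centralizer_lmul_adjoin_iff {k K : Type*} [Field k] [Field K]
    [Algebra k K] (S : Set K) (φ : Module.End k K) :
    φ ∈ Subalgebra.centralizer k ((fun a : K => (Algebra.lmul k K a : Module.End k K)) ''
        (IntermediateField.adjoin k S : Set K)) ↔
      ∀ a ∈ S, ∀ x, φ (a * x) = a * φ x := by
  rw [Subalgebra.mem_centralizer_iff, Set.forall_mem_image]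
  refine ⟨fun h a ha x =>
    (LinearMap.congr_fun (h (IntermediateField.subset_adjoin k S ha)) x).symm, fun h a ha => ?_⟩
  suffices ∀ x, φ (a * x) = a * φ x from LinearMap.ext fun x => (this x).symm
  induction ha using IntermediateField.adjoin_induction with
  | mem a ha => exact h a ha
  | algebraMap r => simp [← Algebra.smul_def]
  | add a b _ _ iha ihb => simp [add_mul, iha, ihb]
  | mul a b _ _ iha ihb => simp [mul_assoc, iha, ihb]
  | inv a _ iha =>
    intro x
    rcases eq_or_ne a 0 with rfl | h0
    · simp
    · rw [eq_inv_mul_iff_mul_eq₀ h0, ← iha, mul_inv_cancel_left₀ h0]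


/-- **Left idealisers of lifted codes** (Corollary `left`).
Let `K/k` be a finite field extension and `C̃ ≤ K^m` a `K`-subspace.  The left
idealiser `L = {φ ∈ End_k(K) : φ (applied entrywise) maps C̃ into C̃}` equals, for
some intermediate field `k ≤ F ≤ K`, the centraliser in `End_k(K)` of the
multiplication operators `{μ_a : a ∈ F}`, i.e. `L = End_F(K) ≅ F^{s×s}` with
`s = [K:F]`. -/
theorem left_idealiser_eq_centralizer {k K : Type*} [Field k] [Field K]
    [Algebra k K] [FiniteDimensional k K] {m : ℕ}
    (C : Submodule K (Fin m → K)) :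
    ∃ F : IntermediateField k K,
      {φ : Module.End k K | ∀ c ∈ C, (fun j => φ (c j) : Fin m → K) ∈ C}
        = (Subalgebra.centralizer k
            ((fun a : K => (Algebra.lmul k K a : Module.End k K)) '' (F : Set K)) :
            Set (Module.End k K)) ∧
      Nonempty ((Subalgebra.centralizer k
            ((fun a : K => (Algebra.lmul k K a : Module.End k K)) '' (F : Set K))) ≃ₐ[k]
        Matrix (Fin (Module.finrank F K)) (Fin (Module.finrank F K)) F) := by
  obtain ⟨n, a, e, heC, he, hC⟩ := C.exists_pivots
  refine ⟨IntermediateField.adjoin k {y | ∃ i j, e i j = y}, ?_,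
    ⟨(IntermediateField.centralizerLmulEquivEnd _).trans
      ((algEquivMatrix (Module.finBasis _ K)).restrictScalars k)⟩⟩
  ext φ
  rw [SetLike.mem_coe, IntermediateField.mem_centralizer_lmul_adjoin_iff, Set.mem_ofPred_eq]
  constructor
  · rintro hφ _ ⟨i, j, rfl⟩ x
    have h := congrFun (hC _ (hφ _ (C.smul_mem x (heC i)))) j
    simpa [he, apply_ite φ, Finset.sum_apply, ite_apply, mul_comm] using h
  · intro hφ c hc
    have h : (fun j => φ (c j)) = ∑ i, φ (c (a i)) • e i := by
      ext j
      rw [congrFun (hC c hc) j]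
      simp only [Finset.sum_apply, Pi.smul_apply, smul_eq_mul, map_sum]
      exact Finset.sum_congr rfl fun i _ => by
        rw [mul_comm, hφ _ ⟨i, j, rfl⟩, mul_comm]
    rw [h]
    exact C.sum_mem fun i _ => C.smul_mem _ (heC i)
end
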